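/- Fix positive integers n, m, d, a matrix M ∈ ℝ^{n×m}, a set Ω ⊆ {1,…,n}×{1,…,m}, a constant α > 0, edge sets ε_X ⊆ {(l₁,l₂) : 1 ≤ l₁ < l₂ ≤ n} and ε_Y ⊆ {(j₁,j₂) : 1 ≤ j₁ < j₂ ≤ m} with positive weights w_l (l ∈ ε_X) and u_j (j ∈ ε_Y). Let E_x ∈ ℝ^{n×|ε_X|} be the matrix whose column indexed by l = (l₁,l₂) ∈ ε_X is e_{l₁} − e_{l₂}, and let E_y ∈ ℝ^{m×|ε_Y|} be defined analogously from ε_Y; assume there exist σ_x, σ_y > 0 such that E_xᵀE_x − σ_x·I and E_yᵀE_y − σ_y·I are positive semidefinite. Let p : ℝ → ℝ satisfy: p(z) ≥ 0 for all z ≥ 0, and there exists ς₀ ≥ 0 such that for every ς > ς₀ and every v ∈ ℝ^d the map u ↦ ς‖u−v‖₂² + p(‖u‖₂) is strongly convex on ℝ^d with some positive modulus. For η > 0 define the augmented Lagrangian L_η(P,Q,X,Y,Λ,V) = (1/2)‖Ψ_Ω(M − XYᵀ)‖_F² + (α/2)(‖X‖_F² + ‖Y‖_F²) + tr(Λᵀ(P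 − XᵀE_x)) + tr(Vᵀ(Q − YᵀE_y)) + (η/2)(‖P − XᵀE_x‖_F² + ‖Q − YᵀE_y‖_F²) + Σ_{l∈ε_X} w_l·p(‖p_l‖₂) + Σ_{j∈ε_Y} u_j·p(‖q_j‖₂), where X ∈ ℝ^{n×d}, Y ∈ ℝ^{m×d}, P, Λ ∈ ℝ^{d×|ε_X|}, Q, V ∈ ℝ^{d×|ε_Y|}, and p_l (resp. q_j) denotes the l-th column of P (resp. j-th column of Q). Then for any constants M_x, M_y > 0 there exists η₁ > 0 with the following property: for every η > η₁ and every sequence U^k = (P^k, Q^k, X^k, Y^k, Λ^k, V^k), k = 1, 2, …, satisfying (a) P^{k+1} is a global minimizer of P ↦ L_η(P, Q^k, X^k, Y^k, Λ^k, V^k); (b) Q^{k+1} is a global minimizer of Q ↦ L_η(P^{k+1}, Q, X^k, Y^k, Λ^k, V^k); (c) X^{k+1} is a global minimizer of X ↦ L_η(P^{k+1}, Q^{k+1}, X, Y^k, Λ^k, V^k) + (1/2)‖X − X^k‖_F²; (d) Y^{k+1} is a global minimizer of Y ↦ L_η(P^{k+1}, Q^{k+1}, X^{k+1}, Y, Λ^k,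 V^k) + (1/2)‖Y − Y^k‖_F²; (e) Λ^{k+1} = Λ^k + η(P^{k+1} − (X^{k+1})ᵀE_x) and V^{k+1} = V^k + η(Q^{k+1} − (Y^{k+1})ᵀE_y); and (f) ‖X^k‖_F² ≤ M_x, ‖Y^k‖_F² ≤ M_y for all k; one has Σ_{k=1}^∞ ‖U^{k+1} − U^k‖_F² < ∞, where ‖U^{k+1} − U^k‖_F² denotes the sum of the squared Frobenius norms of the differences of the six components. -/

import Mathlib

open Matrix BigOperators

/-- Squared Frobenius norm of a real matrix. -/
noncomputable def frobSq {α β : Type*} [Fintype α] [Fintype β] (A : Matrix α β ℝ) : ℝ :=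
  ∑ i, ∑ j, (A i j) ^ 2

/-- Euclidean norm of a vector in `ℝ^d`. -/
noncomputable def vnorm {d : ℕ} (v : Fin d → ℝ) : ℝ :=
  Real.sqrt (∑ i, (v i) ^ 2)

/-- Projection `Ψ_Ω` keeping the entries indexed by `Ω` and zeroing the others. -/
def psiProj {n m : ℕ} (Ω : Finset (Fin n × Fin m)) (A : Matrix (Fin n) (Fin m) ℝ) :
    Matrix (Fin n) (Fin m) ℝ :=
  fun i j => if (i, j) ∈ Ω then A i j else 0

/-- The augmented Lagrangian `L_η(P, Q, X, Y, Λ, V)`. -/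
noncomputable def augLag {n m d : ℕ} {εX εY : Type*} [Fintype εX] [Fintype εY]
    (Ω : Finset (Fin n × Fin m)) (M : Matrix (Fin n) (Fin m) ℝ)
    (α η : ℝ) (p : ℝ → ℝ)
    (Ex : Matrix (Fin n) εX ℝ) (Ey : Matrix (Fin m) εY ℝ)
    (w : εX → ℝ) (u : εY → ℝ)
    (P : Matrix (Fin d) εX ℝ) (Q : Matrix (Fin d) εY ℝ)
    (X : Matrix (Fin n) (Fin d) ℝ) (Y : Matrix (Fin m) (Fin d) ℝ)
    (Λ : Matrix (Fin d) εX ℝ) (V : Matrix (Fin d) εY ℝ) : ℝ :=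
  (1 / 2) * frobSq (psiProj Ω (M - X * Yᵀ))
    + (α / 2) * (frobSq X + frobSq Y)
    + (Λᵀ * (P - Xᵀ * Ex)).trace + (Vᵀ * (Q - Yᵀ * Ey)).trace
    + (η / 2) * (frobSq (P - Xᵀ * Ex) + frobSq (Q - Yᵀ * Ey))
    + ∑ l, w l * p (vnorm fun i => P i l)
    + ∑ j, u j * p (vnorm fun i => Q i j)

section FrobeniusAlgebra

variable {α β γ : Type*} [Fintype α] [Fintype β] [Fintype γ]

theorem frobSq_nonneg (A : Matrix α β ℝ) : 0 ≤ frobSq A :=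
  Finset.sum_nonneg fun _ _ => Finset.sum_nonneg fun _ _ => sq_nonneg _

theorem frobSq_eq_zero {A : Matrix α β ℝ} (h : frobSq A = 0) : A = 0 := by
  ext i j
  have h1 := (Finset.sum_eq_zero_iff_of_nonneg
    (fun i _ => Finset.sum_nonneg fun j _ => sq_nonneg (A i j))).1 h i (Finset.mem_univ i)
  have h2 := (Finset.sum_eq_zero_iff_of_nonneg
    (fun j _ => sq_nonneg (A i j))).1 h1 j (Finset.mem_univ j)
  simpa using h2

theorem trace_transpose_mul_eq_sum (A B : Matrix α β ℝ) :
    (Aᵀ * B).trace = ∑ i, ∑ j, A i j * B i j := by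
  rw [Finset.sum_comm]
  simp [Matrix.trace, Matrix.mul_apply]

theorem frobSq_eq_trace (A : Matrix α β ℝ) : frobSq A = (Aᵀ * A).trace := by
  simp [trace_transpose_mul_eq_sum, frobSq, sq]

theorem frobSq_add (A B : Matrix α β ℝ) :
    frobSq (A + B) = frobSq A + 2 * (Aᵀ * B).trace + frobSq B := by
  simp only [trace_transpose_mul_eq_sum, frobSq, Finset.mul_sum, ← Finset.sum_add_distrib,
    Matrix.add_apply]
  refine Finset.sum_congr rfl fun i _ => Finset.sum_congr rfl fun j _ => ?_
  ring

theorem frobSq_smul (c : ℝ) (A : Matrix α β ℝ) : frobSq (c • A) = c ^ 2 * frobSq A := by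
  simp only [frobSq, Finset.mul_sum, Matrix.smul_apply, smul_eq_mul, mul_pow]

theorem frobSq_transpose (A : Matrix α β ℝ) : frobSq Aᵀ = frobSq A := by
  simp only [frobSq, Matrix.transpose_apply]
  exact Finset.sum_comm

section Norm

open scoped Matrix.Norms.Frobenius

theorem frobSq_eq_norm_sq (A : Matrix α β ℝ) : frobSq A = ‖A‖ ^ 2 := by
  have h := frobSq_nonneg A
  simp only [frobSq] at h
  simp only [Matrix.frobenius_norm_def, ← Real.sqrt_eq_rpow, Real.rpow_two, Real.norm_eq_abs, sq_abs,
    Real.sq_sqrt h, frobSq]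

theorem frobSq_mul_le (A : Matrix α β ℝ) (B : Matrix β γ ℝ) :
    frobSq (A * B) ≤ frobSq A * frobSq B := by
  simp only [frobSq_eq_norm_sq, ← mul_pow]
  gcongr
  exact Matrix.frobenius_norm_mul A B

end Norm

theorem frobSq_add_le (A B : Matrix α β ℝ) : frobSq (A + B) ≤ 2 * (frobSq A + frobSq B) := by
  simp only [frobSq, ← Finset.sum_add_distrib, Finset.mul_sum, Matrix.add_apply]
  refine Finset.sum_le_sum fun i _ => Finset.sum_le_sum fun j _ => ?_
  nlinarith [sq_nonneg (A i j - B i j)]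

theorem frobSq_sub_le (A B : Matrix α β ℝ) : frobSq (A - B) ≤ 2 * (frobSq A + frobSq B) := by
  simp only [frobSq, ← Finset.sum_add_distrib, Finset.mul_sum, Matrix.sub_apply]
  refine Finset.sum_le_sum fun i _ => Finset.sum_le_sum fun j _ => ?_
  nlinarith [sq_nonneg (A i j + B i j)]

/-- A Gram matrix bounded below by `σ` bounds `A ↦ E Aᵀ` below in Frobenius norm. -/
theorem mul_frobSq_le_of_posSemidef [DecidableEq β] {σ : ℝ} {E : Matrix α β ℝ}
    (h : (Eᵀ * E - σ • (1 : Matrix β β ℝ)).PosSemidef) (A : Matrix γ β ℝ) :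
    σ * frobSq A ≤ frobSq (E * Aᵀ) := by
  rw [← frobSq_transpose (E * Aᵀ)]
  simp only [frobSq, Finset.mul_sum]
  rw [← sub_nonneg, ← Finset.sum_sub_distrib]
  refine Finset.sum_nonneg fun i _ => ?_
  have hi := h.dotProduct_mulVec_nonneg (A i)
  have e : star (A i) ⬝ᵥ ((Eᵀ * E - σ • (1 : Matrix β β ℝ)) *ᵥ A i) =
      (E *ᵥ A i) ⬝ᵥ (E *ᵥ A i) - σ * (A i ⬝ᵥ A i) := by
    rw [Matrix.sub_mulVec, dotProduct_sub, Matrix.smul_mulVec, Matrix.one_mulVec,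
      dotProduct_smul, ← Matrix.mulVec_mulVec, Matrix.dotProduct_mulVec, Matrix.vecMul_transpose]
    simp
  rw [e] at hi
  convert hi using 1
  simp [dotProduct, Matrix.mulVec, Matrix.mul_apply, Finset.mul_sum, sq]

/-- Completing the square in the augmented Lagrangian. -/
theorem neg_frobSq_div_le_trace_add {η : ℝ} (hη : 0 < η) (A R : Matrix α β ℝ) :
    -(frobSq A / (2 * η)) ≤ (Aᵀ * R).trace + η / 2 * frobSq R := by
  have h := frobSq_nonneg (A + η • R)
  rw [frobSq_add, frobSq_smul, Matrix.mul_smul, Matrix.trace_smul, smul_eq_mul] at h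
  rw [neg_le_iff_add_nonneg]
  have e : (Aᵀ * R).trace + η / 2 * frobSq R + frobSq A / (2 * η) =
      (frobSq A + 2 * (η * (Aᵀ * R).trace) + η ^ 2 * frobSq R) / (2 * η) := by
    field_simp
    ring
  rw [e]
  positivity

end FrobeniusAlgebra

section Projection

variable {n m : ℕ} (Ω : Finset (Fin n × Fin m))

theorem psiProj_add (A B : Matrix (Fin n) (Fin m) ℝ) :
    psiProj Ω (A + B) = psiProj Ω A + psiProj Ω B := by
  ext i j
  by_cases h : (i, j) ∈ Ω <;> simp [psiProj, h]

theorem psiProj_sub (A B : Matrix (Fin n) (Fin m) ℝ) :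
    psiProj Ω (A - B) = psiProj Ω A - psiProj Ω B := by
  ext i j
  by_cases h : (i, j) ∈ Ω <;> simp [psiProj, h]

theorem psiProj_smul (c : ℝ) (A : Matrix (Fin n) (Fin m) ℝ) :
    psiProj Ω (c • A) = c • psiProj Ω A := by
  ext i j
  by_cases h : (i, j) ∈ Ω <;> simp [psiProj, h]

theorem frobSq_psiProj_le (A : Matrix (Fin n) (Fin m) ℝ) :
    frobSq (psiProj Ω A) ≤ frobSq A := by
  refine Finset.sum_le_sum fun i _ => Finset.sum_le_sum fun j _ => ?_
  by_cases h : (i, j) ∈ Ω <;> simp [psiProj, h, sq_nonneg]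

theorem trace_psiProj_transpose_mul (A B : Matrix (Fin n) (Fin m) ℝ) :
    ((psiProj Ω A)ᵀ * psiProj Ω B).trace = ((psiProj Ω A)ᵀ * B).trace := by
  rw [trace_transpose_mul_eq_sum, trace_transpose_mul_eq_sum]
  refine Finset.sum_congr rfl fun i _ => Finset.sum_congr rfl fun j _ => ?_
  by_cases h : (i, j) ∈ Ω <;> simp [psiProj, h]

theorem psiProj_transpose (A : Matrix (Fin n) (Fin m) ℝ) :
    psiProj (Ω.map (Equiv.prodComm _ _).toEmbedding) Aᵀ = (psiProj Ω A)ᵀ := by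
  ext i j
  simp [psiProj]

end Projection

section Block

variable {n m d : ℕ} {ε : Type*} [Fintype ε] {Ω : Finset (Fin n × Fin m)}
  {M : Matrix (Fin n) (Fin m) ℝ} {α η : ℝ} {E : Matrix (Fin n) ε ℝ}

/-- The part of the proximal augmented Lagrangian that depends on one factor. -/
noncomputable def blockObj (Ω : Finset (Fin n × Fin m)) (M : Matrix (Fin n) (Fin m) ℝ) (α η : ℝ)
    (E : Matrix (Fin n) ε ℝ) (Y : Matrix (Fin m) (Fin d) ℝ) (P Λ : Matrix (Fin d) ε ℝ)
    (X₀ X : Matrix (Fin n) (Fin d) ℝ) : ℝ :=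
  (1 / 2) * frobSq (psiProj Ω (M - X * Yᵀ)) + (α / 2) * frobSq X
    + (Λᵀ * (P - Xᵀ * E)).trace + (η / 2) * frobSq (P - Xᵀ * E)
    + (1 / 2) * frobSq (X - X₀)

/-- The gradient of the smooth part of `blockObj`, the proximal term included. -/
def blockGrad (Ω : Finset (Fin n × Fin m)) (M : Matrix (Fin n) (Fin m) ℝ) (α : ℝ)
    (X₀ X : Matrix (Fin n) (Fin d) ℝ) (Y : Matrix (Fin m) (Fin d) ℝ) :
    Matrix (Fin n) (Fin d) ℝ :=
  α • X + (X - X₀) - psiProj Ω (M - X * Yᵀ) * Y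

theorem blockObj_add_smul (Y : Matrix (Fin m) (Fin d) ℝ) (P Λ : Matrix (Fin d) ε ℝ)
    (X₀ X H : Matrix (Fin n) (Fin d) ℝ) :
    ∃ b : ℝ, ∀ t : ℝ, blockObj Ω M α η E Y P Λ X₀ (X + t • H) =
      blockObj Ω M α η E Y P Λ X₀ X
      + t * ((blockGrad Ω M α X₀ X Y - E * (Λ + η • (P - Xᵀ * E))ᵀ)ᵀ * H).trace
      + t ^ 2 * b := by
  refine ⟨1 / 2 * frobSq (psiProj Ω (H * Yᵀ)) + α / 2 * frobSq H + η / 2 * frobSq (Hᵀ * E)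
    + 1 / 2 * frobSq H, fun t => ?_⟩
  have e1 : psiProj Ω (M - (X + t • H) * Yᵀ) =
      psiProj Ω (M - X * Yᵀ) + (-t) • psiProj Ω (H * Yᵀ) := by
    rw [← psiProj_smul, ← psiProj_add, Matrix.add_mul, Matrix.smul_mul, neg_smul,
      ← sub_eq_add_neg, sub_sub]
  have e2 : P - (X + t • H)ᵀ * E = (P - Xᵀ * E) + (-t) • (Hᵀ * E) := by
    rw [Matrix.transpose_add, Matrix.transpose_smul, Matrix.add_mul, Matrix.smul_mul]
    module
  have e3 : X + t • H - X₀ = (X - X₀) + t • H := by module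
  have c1 (A : Matrix (Fin d) ε ℝ) : ((E * Aᵀ)ᵀ * H).trace = (Aᵀ * (Hᵀ * E)).trace := by
    rw [← Matrix.trace_transpose, Matrix.transpose_mul, Matrix.transpose_transpose,
      Matrix.trace_mul_comm, Matrix.mul_assoc, Matrix.trace_mul_comm, Matrix.mul_assoc]
  have c2 (A : Matrix (Fin n) (Fin m) ℝ) : ((A * Y)ᵀ * H).trace = (Aᵀ * (H * Yᵀ)).trace := by
    rw [Matrix.transpose_mul, Matrix.mul_assoc, Matrix.trace_mul_comm, Matrix.mul_assoc]
  have slope : ((blockGrad Ω M α X₀ X Y - E * (Λ + η • (P - Xᵀ * E))ᵀ)ᵀ * H).trace =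
      α * (Xᵀ * H).trace + ((X - X₀)ᵀ * H).trace
        - ((psiProj Ω (M - X * Yᵀ))ᵀ * (H * Yᵀ)).trace
        - ((Λᵀ * (Hᵀ * E)).trace + η * ((P - Xᵀ * E)ᵀ * (Hᵀ * E)).trace) := by
    rw [Matrix.transpose_sub, Matrix.sub_mul, Matrix.trace_sub, c1, Matrix.transpose_add,
      Matrix.add_mul, Matrix.trace_add, Matrix.transpose_smul, Matrix.smul_mul,
      Matrix.trace_smul, smul_eq_mul, blockGrad, Matrix.transpose_sub, Matrix.sub_mul,
      Matrix.trace_sub, c2, Matrix.transpose_add, Matrix.add_mul, Matrix.trace_add,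
      Matrix.transpose_smul, Matrix.smul_mul, Matrix.trace_smul, smul_eq_mul]
  rw [slope, blockObj, blockObj, e1, e2, e3]
  simp only [frobSq_add, frobSq_smul, Matrix.mul_smul, Matrix.trace_smul,
    trace_psiProj_transpose_mul, Matrix.mul_add, Matrix.trace_add, smul_eq_mul]
  ring

theorem mul_transpose_eq_blockGrad {Y : Matrix (Fin m) (Fin d) ℝ} {P Λ : Matrix (Fin d) ε ℝ}
    {X₀ X : Matrix (Fin n) (Fin d) ℝ}
    (hmin : ∀ X', blockObj Ω M α η E Y P Λ X₀ X ≤ blockObj Ω M α η E Y P Λ X₀ X') :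
    E * (Λ + η • (P - Xᵀ * E))ᵀ = blockGrad Ω M α X₀ X Y := by
  set D := blockGrad Ω M α X₀ X Y - E * (Λ + η • (P - Xᵀ * E))ᵀ with hD
  obtain ⟨b, hb⟩ := blockObj_add_smul (Ω := Ω) (M := M) (α := α) (η := η) (E := E) Y P Λ X₀ X D
  have h : ∀ t : ℝ, 0 ≤ b * (t * t) + frobSq D * t + 0 := fun t => by
    have := hmin (X + t • D)
    rw [hb t, ← hD, ← frobSq_eq_trace] at this
    linarith
  have h0 := discrim_le_zero h
  simp only [discrim, mul_zero, sub_zero] at h0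
  have : D = 0 := frobSq_eq_zero (pow_eq_zero_iff two_ne_zero |>.1 (le_antisymm h0 (sq_nonneg _)))
  exact (sub_eq_zero.1 this).symm

open scoped Matrix.Norms.Frobenius

theorem norm_psiProj_le (A : Matrix (Fin n) (Fin m) ℝ) : ‖psiProj Ω A‖ ≤ ‖A‖ := by
  have := frobSq_psiProj_le Ω A
  rw [frobSq_eq_norm_sq, frobSq_eq_norm_sq] at this
  exact (sq_le_sq₀ (norm_nonneg _) (norm_nonneg _)).1 this

theorem norm_sub_mul_transpose_le {a b : ℝ} {X : Matrix (Fin n) (Fin d) ℝ}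
    {Y : Matrix (Fin m) (Fin d) ℝ} (hX : ‖X‖ ≤ a) (hY : ‖Y‖ ≤ b) :
    ‖M - X * Yᵀ‖ ≤ ‖M‖ + a * b := by
  have h1 := norm_sub_le M (X * Yᵀ)
  have h2 := Matrix.frobenius_norm_mul X Yᵀ
  rw [Matrix.frobenius_norm_transpose] at h2
  have h3 := mul_le_mul hX hY (norm_nonneg _) ((norm_nonneg _).trans hX)
  linarith

theorem norm_blockGrad_le {a b : ℝ} (hα : 0 < α) {X₀ X : Matrix (Fin n) (Fin d) ℝ}
    {Y : Matrix (Fin m) (Fin d) ℝ} (hX₀ : ‖X₀‖ ≤ a) (hX : ‖X‖ ≤ a) (hY : ‖Y‖ ≤ b) :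
    ‖blockGrad Ω M α X₀ X Y‖ ≤ (α + 2) * a + (‖M‖ + a * b) * b := by
  have h1 : ‖α • X‖ ≤ α * a := by
    rw [norm_smul, Real.norm_of_nonneg hα.le]
    gcongr
  have h2 := norm_sub_le X X₀
  have h3 : ‖psiProj Ω (M - X * Yᵀ) * Y‖ ≤ (‖M‖ + a * b) * b := by
    refine (Matrix.frobenius_norm_mul _ _).trans ?_
    have h := norm_sub_mul_transpose_le (M := M) hX hY
    exact mul_le_mul ((norm_psiProj_le _).trans h) hY (norm_nonneg _) ((norm_nonneg _).trans h)
  have h4 := norm_sub_le (α • X + (X - X₀)) (psiProj Ω (M - X * Yᵀ) * Y)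
  have h5 := norm_add_le (α • X) (X - X₀)
  unfold blockGrad
  linarith

theorem norm_blockGrad_sub_le {a b : ℝ} (hα : 0 < α) {X₀ X X₀' X' : Matrix (Fin n) (Fin d) ℝ}
    {Y Y' : Matrix (Fin m) (Fin d) ℝ}
    (hX : ‖X‖ ≤ a) (hX' : ‖X'‖ ≤ a) (hY : ‖Y‖ ≤ b) (hY' : ‖Y'‖ ≤ b) :
    ‖blockGrad Ω M α X₀' X' Y' - blockGrad Ω M α X₀ X Y‖ ≤
      (α + 1 + ‖M‖ + 2 * (a * b) + b ^ 2) * (‖X' - X‖ + ‖X₀' - X₀‖ + ‖Y' - Y‖) := by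
  have ha : 0 ≤ a := (norm_nonneg _).trans hX
  have hb : 0 ≤ b := (norm_nonneg _).trans hY
  have e : blockGrad Ω M α X₀' X' Y' - blockGrad Ω M α X₀ X Y =
      (α + 1) • (X' - X) - (X₀' - X₀) - psiProj Ω (M - X' * Y'ᵀ) * (Y' - Y)
        + psiProj Ω ((X' - X) * Y'ᵀ + X * (Y' - Y)ᵀ) * Y := by
    have : (X' - X) * Y'ᵀ + X * (Y' - Y)ᵀ = (M - X * Yᵀ) - (M - X' * Y'ᵀ) := by
      rw [Matrix.sub_mul, Matrix.transpose_sub, Matrix.mul_sub]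
      abel
    rw [this, psiProj_sub Ω (M - X * Yᵀ), blockGrad, blockGrad, Matrix.sub_mul, Matrix.mul_sub]
    module
  have h1 : ‖(α + 1) • (X' - X)‖ = (α + 1) * ‖X' - X‖ := by
    rw [norm_smul, Real.norm_of_nonneg (by positivity)]
  have h2 : ‖psiProj Ω (M - X' * Y'ᵀ) * (Y' - Y)‖ ≤ (‖M‖ + a * b) * ‖Y' - Y‖ := by
    refine (Matrix.frobenius_norm_mul _ _).trans ?_
    gcongr
    exact (norm_psiProj_le _).trans (norm_sub_mul_transpose_le hX' hY')
  have h3 : ‖psiProj Ω ((X' - X) * Y'ᵀ + X * (Y' - Y)ᵀ) * Y‖ ≤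
      (‖X' - X‖ * b + a * ‖Y' - Y‖) * b := by
    refine (Matrix.frobenius_norm_mul _ _).trans ?_
    gcongr
    refine (norm_psiProj_le _).trans ((norm_add_le _ _).trans ?_)
    have h := Matrix.frobenius_norm_mul (X' - X) Y'ᵀ
    have h' := Matrix.frobenius_norm_mul X (Y' - Y)ᵀ
    rw [Matrix.frobenius_norm_transpose] at h h'
    exact add_le_add (h.trans (by gcongr)) (h'.trans (by gcongr))
  rw [e]
  refine (norm_add_le _ _).trans ?_
  have h4 := norm_sub_le ((α + 1) • (X' - X) - (X₀' - X₀)) (psiProj Ω (M - X' * Y'ᵀ) * (Y' - Y))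
  have h5 := norm_sub_le ((α + 1) • (X' - X)) (X₀' - X₀)
  have p1 := norm_nonneg (X' - X)
  have p2 := norm_nonneg (X₀' - X₀)
  have p3 := norm_nonneg (Y' - Y)
  have q1 : 0 ≤ ‖M‖ * ‖X' - X‖ + 2 * (a * b) * ‖X' - X‖ := by positivity
  have q2 : 0 ≤ (α + ‖M‖ + 2 * (a * b) + b ^ 2) * ‖X₀' - X₀‖ := by positivity
  have q3 : 0 ≤ (α + 1 + b ^ 2) * ‖Y' - Y‖ := by positivity
  nlinarith

end Block

/-- A Lyapunov criterion for summability. -/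
theorem summable_of_descent {L s : ℕ → ℝ} {B : ℝ} (hs : ∀ k, 0 ≤ s k) (hL : ∀ k, B ≤ L k)
    (h : ∀ k, L (k + 1) + 3 / 8 * s (k + 1) ≤ L k + 1 / 8 * s k) : Summable s := by
  have key : ∀ N, 1 / 4 * ∑ i ∈ Finset.range N, s (i + 1) + L N + 1 / 8 * s N ≤
      L 0 + 1 / 8 * s 0 := by
    intro N
    induction N with
    | zero => simp
    | succ N ih =>
      rw [Finset.sum_range_succ]
      linarith [h N]
  refine (summable_nat_add_iff 1).1
    (summable_of_sum_range_le (c := 4 * (L 0 + 1 / 8 * s 0 - B)) (fun k => hs (k + 1)) fun N => ?_)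
  linarith [key N, hL N, hs N]

section Dual

variable {n m d : ℕ} {ε : Type*} [Fintype ε] [DecidableEq ε] {σ : ℝ} {E : Matrix (Fin n) ε ℝ}

open scoped Matrix.Norms.Frobenius

theorem exists_frobSq_dual_le (Ω : Finset (Fin n × Fin m)) (M : Matrix (Fin n) (Fin m) ℝ)
    {α : ℝ} (hα : 0 < α) (hσ : 0 < σ) (hE : (Eᵀ * E - σ • (1 : Matrix ε ε ℝ)).PosSemidef)
    (A B : ℝ) :
    ∃ C : ℝ, ∀ (X₀ X : Matrix (Fin n) (Fin d) ℝ) (Y : Matrix (Fin m) (Fin d) ℝ)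
      (Λ : Matrix (Fin d) ε ℝ), frobSq X₀ ≤ A → frobSq X ≤ A → frobSq Y ≤ B →
      E * Λᵀ = blockGrad Ω M α X₀ X Y → frobSq Λ ≤ C := by
  refine ⟨((α + 2) * √A + (‖M‖ + √A * √B) * √B) ^ 2 / σ, fun X₀ X Y Λ hX₀ hX hY h => ?_⟩
  rw [frobSq_eq_norm_sq] at hX₀ hX hY
  rw [le_div_iff₀' hσ]
  refine (mul_frobSq_le_of_posSemidef hE Λ).trans ?_
  rw [h, frobSq_eq_norm_sq]
  gcongr
  exact norm_blockGrad_le hα (Real.le_sqrt_of_sq_le hX₀) (Real.le_sqrt_of_sq_le hX)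
    (Real.le_sqrt_of_sq_le hY)

theorem exists_frobSq_dual_sub_le (Ω : Finset (Fin n × Fin m)) (M : Matrix (Fin n) (Fin m) ℝ)
    {α : ℝ} (hα : 0 < α) (hσ : 0 < σ) (hE : (Eᵀ * E - σ • (1 : Matrix ε ε ℝ)).PosSemidef)
    (A B : ℝ) :
    ∃ C : ℝ, 0 ≤ C ∧ ∀ (X₀ X X₀' X' : Matrix (Fin n) (Fin d) ℝ) (Y Y' : Matrix (Fin m) (Fin d) ℝ)
      (Λ Λ' : Matrix (Fin d) ε ℝ),
      frobSq X ≤ A → frobSq X' ≤ A → frobSq Y ≤ B → frobSq Y' ≤ B →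
      E * Λᵀ = blockGrad Ω M α X₀ X Y → E * Λ'ᵀ = blockGrad Ω M α X₀' X' Y' →
      frobSq (Λ' - Λ) ≤ C * (frobSq (X' - X) + frobSq (X₀' - X₀) + frobSq (Y' - Y)) := by
  set K := α + 1 + ‖M‖ + 2 * (√A * √B) + √B ^ 2 with hK
  refine ⟨3 * K ^ 2 / σ, by positivity, fun X₀ X X₀' X' Y Y' Λ Λ' hX hX' hY hY' h h' => ?_⟩
  rw [frobSq_eq_norm_sq] at hX hX' hY hY'
  rw [div_mul_eq_mul_div, le_div_iff₀' hσ]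
  refine (mul_frobSq_le_of_posSemidef hE (Λ' - Λ)).trans ?_
  rw [Matrix.transpose_sub, Matrix.mul_sub, h, h']
  simp only [frobSq_eq_norm_sq]
  have key := norm_blockGrad_sub_le (Ω := Ω) (M := M) (X₀ := X₀) (X₀' := X₀') hα
    (Real.le_sqrt_of_sq_le hX) (Real.le_sqrt_of_sq_le hX') (Real.le_sqrt_of_sq_le hY)
    (Real.le_sqrt_of_sq_le hY')
  refine (pow_le_pow_left₀ (norm_nonneg _) key 2).trans ?_
  rw [← hK, mul_pow, mul_comm 3, mul_assoc]
  gcongr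
  nlinarith [sq_nonneg (‖X' - X‖ - ‖X₀' - X₀‖), sq_nonneg (‖X' - X‖ - ‖Y' - Y‖),
    sq_nonneg (‖X₀' - X₀‖ - ‖Y' - Y‖)]

end Dual

section Primal

variable {n d : ℕ} {ε : Type*} [Fintype ε]

theorem summable_frobSq_primal_sub {η : ℝ} (hη : 0 < η) {E : Matrix (Fin n) ε ℝ}
    {P Λ : ℕ → Matrix (Fin d) ε ℝ} {X : ℕ → Matrix (Fin n) (Fin d) ℝ}
    (hΛ : ∀ k, Λ (k + 1) = Λ k + η • (P (k + 1) - (X (k + 1))ᵀ * E))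
    (hX : Summable fun k => frobSq (X (k + 1) - X k))
    (hD : Summable fun k => frobSq (Λ (k + 1) - Λ k)) :
    Summable fun k => frobSq (P (k + 1) - P k) := by
  have hP (k : ℕ) : P (k + 1) = (X (k + 1))ᵀ * E + η⁻¹ • (Λ (k + 1) - Λ k) := by
    rw [hΛ k, add_sub_cancel_left, smul_smul, inv_mul_cancel₀ hη.ne', one_smul]
    abel
  refine (summable_nat_add_iff 1).1 ?_
  have hX1 := ((summable_nat_add_iff 1).2 hX).mul_right (frobSq E)
  have hD1 := (((summable_nat_add_iff 1).2 hD).add hD).mul_left (η⁻¹ ^ 2 * 2)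
  refine Summable.of_nonneg_of_le (fun k => frobSq_nonneg _) (fun k => ?_)
    ((hX1.add hD1).mul_left 2)
  have e : P (k + 1 + 1) - P (k + 1) = (X (k + 1 + 1) - X (k + 1))ᵀ * E +
      η⁻¹ • ((Λ (k + 1 + 1) - Λ (k + 1)) - (Λ (k + 1) - Λ k)) := by
    rw [hP (k + 1), hP k, Matrix.transpose_sub, Matrix.sub_mul]
    module
  rw [e]
  refine (frobSq_add_le _ _).trans ?_
  gcongr
  · refine (frobSq_mul_le _ _).trans_eq ?_
    rw [frobSq_transpose]
  · rw [frobSq_smul, mul_assoc]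
    gcongr
    exact frobSq_sub_le _ _

end Primal

section AugLag

variable {n m d : ℕ} {εX εY : Type*} [Fintype εX] [Fintype εY]
  {Ω : Finset (Fin n × Fin m)} {M : Matrix (Fin n) (Fin m) ℝ} {α η : ℝ} {p : ℝ → ℝ}
  {Ex : Matrix (Fin n) εX ℝ} {Ey : Matrix (Fin m) εY ℝ} {w : εX → ℝ} {u : εY → ℝ}
  {P Λ : Matrix (Fin d) εX ℝ} {Q V : Matrix (Fin d) εY ℝ}
  {X : Matrix (Fin n) (Fin d) ℝ} {Y : Matrix (Fin m) (Fin d) ℝ}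

theorem augLag_dual_update {Λ' : Matrix (Fin d) εX ℝ} {V' : Matrix (Fin d) εY ℝ}
    (hΛ : Λ' = Λ + η • (P - Xᵀ * Ex)) (hV : V' = V + η • (Q - Yᵀ * Ey)) :
    augLag Ω M α η p Ex Ey w u P Q X Y Λ' V' = augLag Ω M α η p Ex Ey w u P Q X Y Λ V
      + 1 / η * (frobSq (Λ' - Λ) + frobSq (V' - V)) := by
  subst hΛ hV
  simp only [augLag, add_sub_cancel_left, frobSq_smul, Matrix.transpose_add,
    Matrix.transpose_smul, Matrix.add_mul, Matrix.smul_mul, Matrix.trace_add, Matrix.trace_smul,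
    smul_eq_mul, ← frobSq_eq_trace]
  field_simp
  ring

theorem neg_dual_le_augLag (hα : 0 < α) (hη : 0 < η) (hp : ∀ z, 0 ≤ z → 0 ≤ p z)
    (hw : ∀ l, 0 < w l) (hu : ∀ j, 0 < u j) :
    -((frobSq Λ + frobSq V) / (2 * η)) ≤ augLag Ω M α η p Ex Ey w u P Q X Y Λ V := by
  have h1 := neg_frobSq_div_le_trace_add hη Λ (P - Xᵀ * Ex)
  have h2 := neg_frobSq_div_le_trace_add hη V (Q - Yᵀ * Ey)
  have h3 : 0 ≤ ∑ l, w l * p (vnorm fun i => P i l) :=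
    Finset.sum_nonneg fun l _ => mul_nonneg (hw l).le (hp _ (Real.sqrt_nonneg _))
  have h4 : 0 ≤ ∑ j, u j * p (vnorm fun i => Q i j) :=
    Finset.sum_nonneg fun j _ => mul_nonneg (hu j).le (hp _ (Real.sqrt_nonneg _))
  have h5 := frobSq_nonneg (psiProj Ω (M - X * Yᵀ))
  have h6 : 0 ≤ α / 2 * (frobSq X + frobSq Y) :=
    mul_nonneg (by positivity) (add_nonneg (frobSq_nonneg _) (frobSq_nonneg _))
  rw [add_div]
  unfold augLag
  linarith

theorem dual_eq_blockGrad_left {Λ' : Matrix (Fin d) εX ℝ} {X₀ : Matrix (Fin n) (Fin d) ℝ}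
    (hmin : ∀ X', augLag Ω M α η p Ex Ey w u P Q X Y Λ V + (1 / 2) * frobSq (X - X₀)
      ≤ augLag Ω M α η p Ex Ey w u P Q X' Y Λ V + (1 / 2) * frobSq (X' - X₀))
    (hΛ : Λ' = Λ + η • (P - Xᵀ * Ex)) :
    Ex * Λ'ᵀ = blockGrad Ω M α X₀ X Y := by
  rw [hΛ]
  refine mul_transpose_eq_blockGrad fun X' => ?_
  have h := hmin X'
  unfold augLag at h
  unfold blockObj
  linarith

theorem dual_eq_blockGrad_right {V' : Matrix (Fin d) εY ℝ} {Y₀ : Matrix (Fin m) (Fin d) ℝ}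
    (hmin : ∀ Y', augLag Ω M α η p Ex Ey w u P Q X Y Λ V + (1 / 2) * frobSq (Y - Y₀)
      ≤ augLag Ω M α η p Ex Ey w u P Q X Y' Λ V + (1 / 2) * frobSq (Y' - Y₀))
    (hV : V' = V + η • (Q - Yᵀ * Ey)) :
    Ey * V'ᵀ = blockGrad (Ω.map (Equiv.prodComm _ _).toEmbedding) Mᵀ α Y₀ Y X := by
  rw [hV]
  refine mul_transpose_eq_blockGrad fun Y' => ?_
  have e (Z : Matrix (Fin m) (Fin d) ℝ) :
      frobSq (psiProj (Ω.map (Equiv.prodComm _ _).toEmbedding) (Mᵀ - Z * Xᵀ)) =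
        frobSq (psiProj Ω (M - X * Zᵀ)) := by
    rw [← frobSq_transpose (psiProj Ω _), ← psiProj_transpose, Matrix.transpose_sub,
      Matrix.transpose_mul, Matrix.transpose_transpose]
  have h := hmin Y'
  unfold augLag at h
  unfold blockObj
  rw [e, e]
  linarith

end AugLag

/-- square summability of the successive differences of the modified ADMM
iterates, for any bounded sequence of exact iterates and any sufficiently large `η`. -/
theorem admm_differences_square_summable
    (n m d : ℕ) (hn : 0 < n) (hm : 0 < m) (hd : 0 < d)
    (M : Matrix (Fin n) (Fin m) ℝ) (Ω : Finset (Fin n × Fin m))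
    (α : ℝ) (hα : 0 < α)
    (εX : Finset (Fin n × Fin n)) (hεX : ∀ l ∈ εX, l.1 < l.2)
    (εY : Finset (Fin m × Fin m)) (hεY : ∀ j ∈ εY, j.1 < j.2)
    (w : ↥εX → ℝ) (hw : ∀ l, 0 < w l)
    (u : ↥εY → ℝ) (hu : ∀ j, 0 < u j)
    (Ex : Matrix (Fin n) ↥εX ℝ)
    (hEx : ∀ (i : Fin n) (l : ↥εX), Ex i l =
      (if i = (l : Fin n × Fin n).1 then (1 : ℝ) else 0) -
      (if i = (l : Fin n × Fin n).2 then (1 : ℝ) else 0))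
    (Ey : Matrix (Fin m) ↥εY ℝ)
    (hEy : ∀ (i : Fin m) (j : ↥εY), Ey i j =
      (if i = (j : Fin m × Fin m).1 then (1 : ℝ) else 0) -
      (if i = (j : Fin m × Fin m).2 then (1 : ℝ) else 0))
    (σx σy : ℝ) (hσx : 0 < σx) (hσy : 0 < σy)
    (hpsdx : (Exᵀ * Ex - σx • (1 : Matrix ↥εX ↥εX ℝ)).PosSemidef)
    (hpsdy : (Eyᵀ * Ey - σy • (1 : Matrix ↥εY ↥εY ℝ)).PosSemidef)
    (p : ℝ → ℝ) (hp : ∀ z : ℝ, 0 ≤ z → 0 ≤ p z)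
    (ς₀ : ℝ) (hς₀ : 0 ≤ ς₀)
    (hconv : ∀ ς : ℝ, ς₀ < ς → ∀ v : EuclideanSpace ℝ (Fin d),
      ∃ c : ℝ, 0 < c ∧ ConvexOn ℝ Set.univ
        (fun x : EuclideanSpace ℝ (Fin d) =>
          ς * ‖x - v‖ ^ 2 + p ‖x‖ - (c / 2) * ‖x‖ ^ 2))
    (Mx My : ℝ) (hMx : 0 < Mx) (hMy : 0 < My) :
    ∃ η₁ : ℝ, 0 < η₁ ∧ ∀ η : ℝ, η₁ < η →
      ∀ (Pseq : ℕ → Matrix (Fin d) ↥εX ℝ) (Qseq : ℕ → Matrix (Fin d) ↥εY ℝ)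
        (Xseq : ℕ → Matrix (Fin n) (Fin d) ℝ) (Yseq : ℕ → Matrix (Fin m) (Fin d) ℝ)
        (Λseq : ℕ → Matrix (Fin d) ↥εX ℝ) (Vseq : ℕ → Matrix (Fin d) ↥εY ℝ),
        (∀ (k : ℕ) (P' : Matrix (Fin d) ↥εX ℝ),
          augLag Ω M α η p Ex Ey w u (Pseq (k + 1)) (Qseq k) (Xseq k) (Yseq k)
              (Λseq k) (Vseq k)
            ≤ augLag Ω M α η p Ex Ey w u P' (Qseq k) (Xseq k) (Yseq k)
              (Λseq k) (Vseq k)) →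
        (∀ (k : ℕ) (Q' : Matrix (Fin d) ↥εY ℝ),
          augLag Ω M α η p Ex Ey w u (Pseq (k + 1)) (Qseq (k + 1)) (Xseq k) (Yseq k)
              (Λseq k) (Vseq k)
            ≤ augLag Ω M α η p Ex Ey w u (Pseq (k + 1)) Q' (Xseq k) (Yseq k)
              (Λseq k) (Vseq k)) →
        (∀ (k : ℕ) (X' : Matrix (Fin n) (Fin d) ℝ),
          augLag Ω M α η p Ex Ey w u (Pseq (k + 1)) (Qseq (k + 1)) (Xseq (k + 1)) (Yseq k)
              (Λseq k) (Vseq k) + (1 / 2) * frobSq (Xseq (k + 1) - Xseq k)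
            ≤ augLag Ω M α η p Ex Ey w u (Pseq (k + 1)) (Qseq (k + 1)) X' (Yseq k)
              (Λseq k) (Vseq k) + (1 / 2) * frobSq (X' - Xseq k)) →
        (∀ (k : ℕ) (Y' : Matrix (Fin m) (Fin d) ℝ),
          augLag Ω M α η p Ex Ey w u (Pseq (k + 1)) (Qseq (k + 1)) (Xseq (k + 1))
              (Yseq (k + 1)) (Λseq k) (Vseq k)
              + (1 / 2) * frobSq (Yseq (k + 1) - Yseq k)
            ≤ augLag Ω M α η p Ex Ey w u (Pseq (k + 1)) (Qseq (k + 1)) (Xseq (k + 1)) Y'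
              (Λseq k) (Vseq k) + (1 / 2) * frobSq (Y' - Yseq k)) →
        (∀ k : ℕ, Λseq (k + 1) = Λseq k + η • (Pseq (k + 1) - (Xseq (k + 1))ᵀ * Ex)) →
        (∀ k : ℕ, Vseq (k + 1) = Vseq k + η • (Qseq (k + 1) - (Yseq (k + 1))ᵀ * Ey)) →
        (∀ k : ℕ, frobSq (Xseq k) ≤ Mx) →
        (∀ k : ℕ, frobSq (Yseq k) ≤ My) →
        Summable (fun k : ℕ =>
          frobSq (Pseq (k + 1) - Pseq k) + frobSq (Qseq (k + 1) - Qseq k)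
            + frobSq (Xseq (k + 1) - Xseq k) + frobSq (Yseq (k + 1) - Yseq k)
            + frobSq (Λseq (k + 1) - Λseq k) + frobSq (Vseq (k + 1) - Vseq k)) := by
  obtain ⟨Bx, hBx⟩ := exists_frobSq_dual_le (d := d) Ω M hα hσx hpsdx Mx My
  obtain ⟨By, hBy⟩ := exists_frobSq_dual_le (d := d) (Ω.map (Equiv.prodComm _ _).toEmbedding) Mᵀ
    hα hσy hpsdy My Mx
  obtain ⟨Cx, hCx₀, hCx⟩ := exists_frobSq_dual_sub_le (d := d) Ω M hα hσx hpsdx Mx My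
  obtain ⟨Cy, hCy₀, hCy⟩ := exists_frobSq_dual_sub_le (d := d)
    (Ω.map (Equiv.prodComm _ _).toEmbedding) Mᵀ hα hσy hpsdy My Mx
  refine ⟨8 * (Cx + Cy) + 1, by positivity, fun η hη P Q X Y Λ V hPmin hQmin hXmin hYmin
    hΛ hV hXb hYb => ?_⟩
  have hη₀ : 0 < η := lt_trans (by positivity) hη
  have gx (k : ℕ) := dual_eq_blockGrad_left (hXmin k) (hΛ k)
  have gy (k : ℕ) := dual_eq_blockGrad_right (hYmin k) (hV k)
  have hx₀ (k : ℕ) := frobSq_nonneg (X (k + 1) - X k)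
  have hy₀ (k : ℕ) := frobSq_nonneg (Y (k + 1) - Y k)
  have hdx (k : ℕ) := hCx _ _ _ _ _ _ _ _ (hXb _) (hXb _) (hYb _) (hYb _) (gx k) (gx (k + 1))
  have hdy (k : ℕ) := hCy _ _ _ _ _ _ _ _ (hYb _) (hYb _) (hXb _) (hXb _) (gy k) (gy (k + 1))
  set L : ℕ → ℝ := fun k => augLag Ω M α η p Ex Ey w u (P k) (Q k) (X k) (Y k) (Λ k) (V k) with hL
  set s : ℕ → ℝ := fun k => frobSq (X (k + 1) - X k) + frobSq (Y (k + 1) - Y k) with hs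
  have hs₀ (k : ℕ) : 0 ≤ s k := add_nonneg (hx₀ k) (hy₀ k)
  have dual_le (k : ℕ) : frobSq (Λ (k + 1 + 1) - Λ (k + 1)) + frobSq (V (k + 1 + 1) - V (k + 1)) ≤
      (Cx + Cy) * (s (k + 1) + s k) := by
    have h1 : frobSq (Λ (k + 1 + 1) - Λ (k + 1)) ≤ Cx * (s (k + 1) + s k) :=
      (hdx k).trans (mul_le_mul_of_nonneg_left (by simp only [hs]; linarith [hy₀ (k + 1)]) hCx₀)
    have h2 : frobSq (V (k + 1 + 1) - V (k + 1)) ≤ Cy * (s (k + 1) + s k) :=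
      (hdy k).trans (mul_le_mul_of_nonneg_left (by simp only [hs]; linarith [hx₀ k]) hCy₀)
    linarith
  have descent (k : ℕ) : L (k + 1) + 1 / 2 * s k ≤
      L k + 1 / η * (frobSq (Λ (k + 1) - Λ k) + frobSq (V (k + 1) - V k)) := by
    have h0 := augLag_dual_update (Ω := Ω) (M := M) (α := α) (p := p) (w := w) (u := u)
      (hΛ k) (hV k)
    have h1 := hPmin k (P k)
    have h2 := hQmin k (Q k)
    have h3 := hXmin k (X k)
    have h4 := hYmin k (Y k)
    have z {r : ℕ} (A : Matrix (Fin r) (Fin d) ℝ) : frobSq (A - A) = 0 := by simp [frobSq]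
    rw [z] at h3 h4
    simp only [hL, hs]
    linarith
  have small : 1 / η * (Cx + Cy) ≤ 1 / 8 := by
    rw [one_div_mul_eq_div, div_le_iff₀ hη₀]
    linarith
  have hsum : Summable s := by
    refine summable_of_descent (L := fun k => L (k + 1)) (B := -((Bx + By) / (2 * η))) hs₀
      (fun k => ?_) (fun k => ?_)
    · refine le_trans ?_ (neg_dual_le_augLag hα hη₀ hp hw hu)
      have h1 := hBx _ _ _ _ (hXb _) (hXb _) (hYb _) (gx k)
      have h2 := hBy _ _ _ _ (hYb _) (hYb _) (hXb _) (gy k)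
      gcongr
    · have h1 := mul_le_mul_of_nonneg_left (dual_le k) (one_div_nonneg.2 hη₀.le)
      have h2 := mul_le_mul_of_nonneg_right small (add_nonneg (hs₀ (k + 1)) (hs₀ k))
      have h3 := descent (k + 1)
      linarith
  have sX : Summable fun k => frobSq (X (k + 1) - X k) :=
    Summable.of_nonneg_of_le hx₀ (fun k => le_add_of_nonneg_right (hy₀ k)) hsum
  have sY : Summable fun k => frobSq (Y (k + 1) - Y k) :=
    Summable.of_nonneg_of_le hy₀ (fun k => le_add_of_nonneg_left (hx₀ k)) hsum
  have sDual : Summable fun k => (Cx + Cy) * (s (k + 1) + s k) :=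
    (((summable_nat_add_iff 1).2 hsum).add hsum).mul_left _
  have sΛ : Summable fun k => frobSq (Λ (k + 1) - Λ k) :=
    (summable_nat_add_iff 1).1 (Summable.of_nonneg_of_le (fun _ => frobSq_nonneg _)
      (fun k => (le_add_of_nonneg_right (frobSq_nonneg _)).trans (dual_le k)) sDual)
  have sV : Summable fun k => frobSq (V (k + 1) - V k) :=
    (summable_nat_add_iff 1).1 (Summable.of_nonneg_of_le (fun _ => frobSq_nonneg _)
      (fun k => (le_add_of_nonneg_left (frobSq_nonneg _)).trans (dual_le k)) sDual)
  exact (((((summable_frobSq_primal_sub hη₀ hΛ sX sΛ).add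
    (summable_frobSq_primal_sub hη₀ hV sY sV)).add sX).add sY).add sΛ).add sV
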